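/- The index set BCL = {e : e codes a u.c.e. family that is TxtBC-learnable by some learner} is a Σ⁰₅ set, i.e., membership in BCL is definable by a Σ⁰₅ predicate. -/

import Mathlib

/-- `Wset e` is the `e`-th computably enumerable set: the domain of the `e`-th
partial computable function in the standard numbering by codes. -/
def Wset (e : ℕ) : Set ℕ :=
  {x | ((Denumerable.ofNat Nat.Partrec.Code e).eval x).Dom}

/-- The `i`-th column `{x : ⟨i,x⟩ ∈ W_a}` of the c.e. set coded by `a`;
the number `a` codes the u.c.e. family whose members are its columns. -/
def column (a i : ℕ) : Set ℕ := {x | Nat.pair i x ∈ Wset a}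

/-- The initial segment of length `n` of an enumeration `f`. -/
def initSeg (f : ℕ → ℕ) (n : ℕ) : List ℕ := (List.range n).map f

/-- The `m`-th computable learner in the standard effective enumeration of all
partial computable functions from finite sequences to ℕ. -/
def learnerOfCode (m : ℕ) : List ℕ →. ℕ :=
  fun σ => (Denumerable.ofNat Nat.Partrec.Code m).eval (Encodable.encode σ)

/-- `M` TxtFin-identifies the enumeration `f` (here `Option.none` plays the
role of the symbol `?`). -/
def TxtFinIdentifies (M : List ℕ →. Option ℕ) (f : ℕ → ℕ) : Prop :=
  ∃ n h, (∀ n' < n, M (initSeg f n') = Part.some Option.none) ∧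
    M (initSeg f n) = Part.some (Option.some h) ∧ Wset h = Set.range f

/-- `M` TxtFin-learns the set `S`. -/
def TxtFinLearnsSet (M : List ℕ →. Option ℕ) (S : Set ℕ) : Prop :=
  ∀ f : ℕ → ℕ, Set.range f = S → TxtFinIdentifies M f

/-- `M` TxtEx-identifies the enumeration `f`. -/
def TxtExIdentifies (M : List ℕ →. ℕ) (f : ℕ → ℕ) : Prop :=
  ∃ n, (∃ N, ∀ i ≥ N, M (initSeg f i) = Part.some n) ∧ Wset n = Set.range f

/-- `M` TxtEx-learns the set `S`. -/
def TxtExLearnsSet (M : List ℕ →. ℕ) (S : Set ℕ) : Prop :=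
  ∀ f : ℕ → ℕ, Set.range f = S → TxtExIdentifies M f

/-- `M` TxtBC-identifies the enumeration `f`. -/
def TxtBCIdentifies (M : List ℕ →. ℕ) (f : ℕ → ℕ) : Prop :=
  ∃ N, ∀ i ≥ N, ∃ h, M (initSeg f i) = Part.some h ∧ Wset h = Set.range f

/-- `M` TxtBC-learns the set `S`. -/
def TxtBCLearnsSet (M : List ℕ →. ℕ) (S : Set ℕ) : Prop :=
  ∀ f : ℕ → ℕ, Set.range f = S → TxtBCIdentifies M f

/-- `M` TxtEx*-identifies the enumeration `f`. -/
def TxtExStarIdentifies (M : List ℕ →. ℕ) (f : ℕ → ℕ) : Prop :=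
  ∃ n, (∃ N, ∀ i ≥ N, M (initSeg f i) = Part.some n) ∧
    (symmDiff (Wset n) (Set.range f)).Finite

/-- `M` TxtEx*-learns the set `S`. -/
def TxtExStarLearnsSet (M : List ℕ →. ℕ) (S : Set ℕ) : Prop :=
  ∀ f : ℕ → ℕ, Set.range f = S → TxtExStarIdentifies M f

/-- Indices of cofinite c.e. sets. -/
def COF : Set ℕ := {e | (Wset e)ᶜ.Finite}

/-- Indices of coinfinite c.e. sets. -/
def COINF : Set ℕ := {e | (Wset e)ᶜ.Infinite}

/-- `P` is Σ⁰₃: definable by `∃∀∃` over a computable relation. -/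
def IsSigma3 (P : Set ℕ) : Prop :=
  ∃ R : ℕ → ℕ → ℕ → ℕ → Bool,
    Computable (fun p : ℕ × ℕ × ℕ × ℕ => R p.1 p.2.1 p.2.2.1 p.2.2.2) ∧
    ∀ e, e ∈ P ↔ ∃ x, ∀ y, ∃ z, R e x y z = true

/-- `P` is Σ⁰₄: definable by `∃∀∃∀` over a computable relation. -/
def IsSigma4 (P : Set ℕ) : Prop :=
  ∃ R : ℕ → ℕ → ℕ → ℕ → ℕ → Bool,
    Computable (fun p : ℕ × ℕ × ℕ × ℕ × ℕ =>
      R p.1 p.2.1 p.2.2.1 p.2.2.2.1 p.2.2.2.2) ∧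
    ∀ e, e ∈ P ↔ ∃ x, ∀ y, ∃ z, ∀ w, R e x y z w = true

/-- `P` is Σ⁰₅: definable by `∃∀∃∀∃` over a computable relation. -/
def IsSigma5 (P : Set ℕ) : Prop :=
  ∃ R : ℕ → ℕ → ℕ → ℕ → ℕ → ℕ → Bool,
    Computable (fun p : ℕ × ℕ × ℕ × ℕ × ℕ × ℕ =>
      R p.1 p.2.1 p.2.2.1 p.2.2.2.1 p.2.2.2.2.1 p.2.2.2.2.2) ∧
    ∀ e, e ∈ P ↔ ∃ x, ∀ y, ∃ z, ∀ w, ∃ v, R e x y z w v = true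

/-- `f : ℕ → ℕ` is Δ⁰₂: the pointwise limit of a computable function. -/
def IsDelta2Fun (f : ℕ → ℕ) : Prop :=
  ∃ g : ℕ → ℕ → ℕ, Computable₂ g ∧ ∀ x, ∃ s₀, ∀ s ≥ s₀, g s x = f x

/-- The index set of codes of TxtBC-learnable u.c.e. families. -/
def BCL : Set ℕ :=
  {e | ∃ M : List ℕ →. ℕ, Partrec M ∧ ∀ i, TxtBCLearnsSet M (column e i)}

open Filter

/-! ### Stage approximations of r.e. predicates -/

/-- An r.e. predicate is the increasing union of uniformly primitive recursive stages. -/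
theorem REPred.exists_primrecRel_stage {α : Type*} [Primcodable α] {p : α → Prop}
    (hp : REPred p) :
    ∃ T : ℕ → α → Prop, PrimrecRel T ∧ (∀ a k l, k ≤ l → T k a → T l a) ∧
      ∀ a, p a ↔ ∃ k, T k a := by
  obtain ⟨c, hc⟩ := Nat.Partrec.Code.exists_code.1 hp
  refine ⟨fun k a => (Nat.Partrec.Code.evaln k c (Encodable.encode a)).isSome, ?_, ?_, ?_⟩
  · refine Primrec.primrecPred ?_
    simp only [Bool.decide_eq_true]
    exact Primrec.option_isSome.comp (Nat.Partrec.Code.primrec_evaln.comp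
      ((Primrec.fst.pair (Primrec.const c)).pair (Primrec.encode.comp Primrec.snd)))
  · intro a k l hkl h
    obtain ⟨x, hx⟩ := Option.isSome_iff_exists.1 h
    exact Option.isSome_iff_exists.2 ⟨x, Nat.Partrec.Code.evaln_mono hkl hx⟩
  · intro a
    have key : p a ↔ ∃ x, x ∈ Nat.Partrec.Code.eval c (Encodable.encode a) := by
      rw [hc]
      simp [Encodable.encodek, Part.mem_assert_iff]
    rw [key]
    simp only [Nat.Partrec.Code.evaln_complete, Option.isSome_iff_exists]
    exact exists_comm

/-- The set conjectured by a learner on a finite sequence, empty where the learner diverges. -/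
def conjecture (M : List ℕ →. ℕ) (σ : List ℕ) : Set ℕ := {x | ∃ h ∈ M σ, x ∈ Wset h}

theorem conjecture_eq_of_eq_some {M : List ℕ →. ℕ} {σ : List ℕ} {h : ℕ}
    (hM : M σ = Part.some h) : conjecture M σ = Wset h := by
  ext x
  simp [conjecture, hM]

theorem partrec_eval_ofNat :
    Partrec₂ fun e x : ℕ => (Denumerable.ofNat Nat.Partrec.Code e).eval x :=
  Nat.Partrec.Code.eval_part.comp₂ ((Computable.ofNat _).comp Computable.fst).to₂
    Computable.snd.to₂

theorem REPred.mem_Wset {α : Type*} [Primcodable α] {f g : α → ℕ} (hf : Computable f)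
    (hg : Computable g) : REPred fun a => g a ∈ Wset (f a) :=
  (partrec_eval_ofNat.comp hf hg).dom_re

theorem REPred.mem_conjecture {α : Type*} [Primcodable α] {M : α → List ℕ →. ℕ}
    {σ : α → List ℕ} {x : α → ℕ} (hM : Partrec fun a => M a (σ a)) (hx : Computable x) :
    REPred fun a => x a ∈ conjecture (M a) (σ a) := by
  refine (Partrec.dom_re (Partrec.bind hM (g := fun a h =>
    (Denumerable.ofNat Nat.Partrec.Code h).eval (x a)) ?_)).of_eq fun a => ?_
  · exact partrec_eval_ofNat.comp₂ Computable.snd.to₂ (hx.comp Computable.fst).to₂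
  · simp only [Part.bind_dom, conjecture, Wset, Set.mem_ofPred_eq]
    exact ⟨fun ⟨h, h'⟩ => ⟨_, Part.get_mem h, h'⟩, fun ⟨h, hh, h'⟩ => ⟨Part.dom_iff_mem.2 ⟨h, hh⟩,
      by rwa [Part.get_eq_of_mem hh]⟩⟩

theorem partrec_learnerOfCode : Partrec₂ learnerOfCode :=
  partrec_eval_ofNat.comp₂ Computable.fst.to₂ (Computable.encode.comp Computable.snd).to₂

theorem Partrec.exists_learnerOfCode {M : List ℕ →. ℕ} (hM : Partrec M) :
    ∃ c, learnerOfCode c = M := by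
  obtain ⟨c, hc⟩ := Nat.Partrec.Code.exists_code.1 hM
  refine ⟨Encodable.encode c, funext fun σ => ?_⟩
  simp [learnerOfCode, hc, Part.map_id']

/-! ### Content locking -/

/-- The filter of properties of finite sequences from `L` that hold as soon as the sequence is
long enough and contains sufficiently many elements of `L`. -/
def contentFilter (L : Set ℕ) : Filter (List ℕ) where
  sets := {Q | ∃ σ : List ℕ, (∀ y ∈ σ, y ∈ L) ∧ ∀ τ : List ℕ, (∀ y ∈ τ, y ∈ L) →
    (∀ y ∈ σ, y ∈ τ) → σ.length ≤ τ.length → τ ∈ Q}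
  univ_sets := ⟨[], by simp⟩
  sets_of_superset := by
    rintro P Q ⟨σ, hσ, h⟩ hPQ
    exact ⟨σ, hσ, fun τ h₁ h₂ h₃ => hPQ (h τ h₁ h₂ h₃)⟩
  inter_sets := by
    rintro P Q ⟨σ, hσ, h⟩ ⟨σ', hσ', h'⟩
    refine ⟨σ ++ σ', ?_, fun τ h₁ h₂ h₃ => ⟨h τ h₁ ?_ ?_, h' τ h₁ ?_ ?_⟩⟩ <;>
      simp only [List.mem_append, List.length_append] at * <;> grind

theorem eventually_contentFilter {L : Set ℕ} {Q : List ℕ → Prop} :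
    (∀ᶠ τ in contentFilter L, Q τ) ↔ ∃ σ : List ℕ, (∀ y ∈ σ, y ∈ L) ∧ ∀ τ : List ℕ,
      (∀ y ∈ τ, y ∈ L) → (∀ y ∈ σ, y ∈ τ) → σ.length ≤ τ.length → Q τ := Iff.rfl

theorem eventually_forall_mem_contentFilter (L : Set ℕ) :
    ∀ᶠ τ in contentFilter L, ∀ y ∈ τ, y ∈ L :=
  eventually_contentFilter.2 ⟨[], by simp, fun _ h _ _ => h⟩

theorem eventually_mem_iff_contentFilter (L : Set ℕ) (x : ℕ) :
    ∀ᶠ τ in contentFilter L, (x ∈ τ ↔ x ∈ L) := by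
  by_cases hx : x ∈ L
  · exact eventually_contentFilter.2
      ⟨[x], by simpa using hx, fun τ _ h _ => by simpa [hx] using h⟩
  · exact eventually_contentFilter.2
      ⟨[], by simp, fun τ h _ _ => ⟨h x, fun h => absurd h hx⟩⟩

theorem eventually_le_length_contentFilter {L : Set ℕ} (hL : L.Nonempty) (n : ℕ) :
    ∀ᶠ τ in contentFilter L, n ≤ τ.length := by
  obtain ⟨a, ha⟩ := hL
  exact eventually_contentFilter.2 ⟨List.replicate n a,
    fun y hy => (List.eq_of_mem_replicate hy) ▸ ha, fun τ _ _ h => by simpa using h⟩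

/-- `M` content-locks on `L`: on sequences from `L` that are long enough and contain enough
elements of `L`, regardless of their order, `M` conjectures `L`. -/
def ContentLocks (M : List ℕ →. ℕ) (L : Set ℕ) : Prop :=
  ∃ σ : List ℕ, (∀ y ∈ σ, y ∈ L) ∧ ∀ τ : List ℕ, (∀ y ∈ τ, y ∈ L) → (∀ y ∈ σ, y ∈ τ) →
    σ.length < τ.length → conjecture M τ = L

theorem mem_initSeg {f : ℕ → ℕ} {n y : ℕ} : y ∈ initSeg f n ↔ ∃ k < n, f k = y := by
  simp [initSeg]

theorem length_initSeg (f : ℕ → ℕ) (n : ℕ) : (initSeg f n).length = n := by simp [initSeg]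

theorem ContentLocks.txtBCLearnsSet {M : List ℕ →. ℕ} {L : Set ℕ} (h : ContentLocks M L) :
    TxtBCLearnsSet M L := by
  rintro f rfl
  obtain ⟨σ, hσ, h⟩ := h
  have hev : ∀ᶠ n in atTop, ∀ y ∈ σ, y ∈ initSeg f n := by
    refine (eventually_all_finite σ.finite_toSet).2 fun y hy => ?_
    obtain ⟨k, rfl⟩ := hσ y hy
    filter_upwards [eventually_gt_atTop k] with n hn using mem_initSeg.2 ⟨k, hn, rfl⟩
  obtain ⟨N, hN⟩ := eventually_atTop.1 (hev.and (eventually_gt_atTop σ.length))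
  refine ⟨N, fun i hi => ?_⟩
  have hconj := h (initSeg f i) (fun y hy => by obtain ⟨k, -, rfl⟩ := mem_initSeg.1 hy; simp)
    (hN i hi).1 (by simpa [length_initSeg] using (hN i hi).2)
  obtain ⟨e, he, -⟩ : f 0 ∈ conjecture M (initSeg f i) := hconj ▸ ⟨0, rfl⟩
  have he := Part.eq_some_iff.2 he
  exact ⟨e, he, by rw [← conjecture_eq_of_eq_some he, hconj]⟩

/-! ### The witness chain -/

/-- The number `p` codes a pair `(ρ, z)` such that `ρ` is a nonempty sequence from `A`, containing
`j` if `A` does, and `z` shows that the set `U (g ++ ρ)` differs from `A`. -/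
def IsWitness (A : ℕ → Prop) (U : List ℕ → ℕ → Prop) (g : List ℕ) (j p : ℕ) : Prop :=
  (Denumerable.ofNat (List ℕ × ℕ) p).1 ≠ [] ∧
  (∀ y ∈ (Denumerable.ofNat (List ℕ × ℕ) p).1, A y) ∧
  (A j → j ∈ (Denumerable.ofNat (List ℕ × ℕ) p).1) ∧
  ¬(A (Denumerable.ofNat (List ℕ × ℕ) p).2 ↔
    U (g ++ (Denumerable.ofNat (List ℕ × ℕ) p).1) (Denumerable.ofNat (List ℕ × ℕ) p).2)

open Classical in
/-- Append to `g` the sequence coded by the least witness below `n`, if there is one. -/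
noncomputable def witnessStep (A : ℕ → Prop) (U : List ℕ → ℕ → Prop) (n : ℕ) (g : List ℕ)
    (j : ℕ) : List ℕ :=
  let p := (List.range n).findIdx fun p => decide (IsWitness A U g j p)
  if p < n then g ++ (Denumerable.ofNat (List ℕ × ℕ) p).1 else g

/-- Iterate `witnessStep`, starting from the empty sequence. -/
noncomputable def witnessChain (A : ℕ → Prop) (U : List ℕ → ℕ → Prop) (n j : ℕ) : List ℕ :=
  Nat.rec [] (fun j g => witnessStep A U n g j) j

theorem witnessStep_of_isLeast {A : ℕ → Prop} {U : List ℕ → ℕ → Prop} {n j p : ℕ}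
    {g : List ℕ} (hn : p < n) (hp : IsWitness A U g j p)
    (hlt : ∀ q < p, ¬IsWitness A U g j q) :
    witnessStep A U n g j = g ++ (Denumerable.ofNat (List ℕ × ℕ) p).1 := by
  classical
  have : ((List.range n).findIdx fun p => decide (IsWitness A U g j p)) = p := by
    rw [List.findIdx_eq (by simpa using hn)]
    simpa using ⟨hp, hlt⟩
  simp only [witnessStep]
  simp only [this, hn, if_true]

theorem prefix_witnessStep (A : ℕ → Prop) (U : List ℕ → ℕ → Prop) (n : ℕ) (g : List ℕ) (j : ℕ) :
    g <+: witnessStep A U n g j := by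
  simp only [witnessStep]
  split_ifs
  · exact List.prefix_append _ _
  · exact List.prefix_refl _

theorem forall_mem_witnessStep {A : ℕ → Prop} {U : List ℕ → ℕ → Prop} {n : ℕ} {g : List ℕ}
    {j : ℕ} (hg : ∀ y ∈ g, A y) : ∀ y ∈ witnessStep A U n g j, A y := by
  classical
  simp only [witnessStep]
  split_ifs with h
  · intro y hy
    have hw := List.findIdx_getElem (xs := List.range n)
      (p := fun p => decide (IsWitness A U g j p)) (w := by simpa using h)
    simp only [List.getElem_range, decide_eq_true_eq] at hw
    rcases List.mem_append.1 hy with hy | hy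
    · exact hg y hy
    · exact hw.2.1 y hy
  · exact hg

theorem forall_mem_witnessChain (A : ℕ → Prop) (U : List ℕ → ℕ → Prop) (n j : ℕ) :
    ∀ y ∈ witnessChain A U n j, A y := by
  induction j with
  | zero => simp [witnessChain]
  | succ j ih => exact forall_mem_witnessStep ih

theorem witnessChain_prefix (A : ℕ → Prop) (U : List ℕ → ℕ → Prop) (n : ℕ) {i j : ℕ}
    (hij : i ≤ j) : witnessChain A U n i <+: witnessChain A U n j := by
  induction j, hij using Nat.le_induction with
  | base => exact List.prefix_refl _
  | succ j _ ih => exact ih.trans (prefix_witnessStep _ _ _ _ _)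

/-- A chain of proper extensions, each conjectured incorrectly, gives an enumeration that is not
identified. -/
theorem not_txtBCLearnsSet_of_chain {M : List ℕ →. ℕ} {L : Set ℕ} {g ρ : ℕ → List ℕ}
    (hg : ∀ j, g (j + 1) = g j ++ ρ j) (hg0 : g 0 = []) (hne : ∀ j, ρ j ≠ [])
    (hmem : ∀ j, ∀ y ∈ ρ j, y ∈ L) (hcov : ∀ j ∈ L, j ∈ ρ j)
    (hfail : ∀ j, conjecture M (g (j + 1)) ≠ L) : ¬TxtBCLearnsSet M L := by
  have hpre : ∀ {i j}, i ≤ j → g i <+: g j := by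
    intro i j hij
    induction j, hij using Nat.le_induction with
    | base => exact List.prefix_refl _
    | succ j _ ih => exact ih.trans (hg j ▸ List.prefix_append _ _)
  have hlen : ∀ j, j ≤ (g j).length := by
    intro j
    induction j with
    | zero => simp
    | succ j ih =>
      have := List.length_pos_iff.2 (hne j)
      rw [hg, List.length_append]
      omega
  have hgL : ∀ j, ∀ y ∈ g j, y ∈ L := by
    intro j
    induction j with
    | zero => simp [hg0]
    | succ j ih =>
      intro y hy
      rw [hg] at hy
      rcases List.mem_append.1 hy with hy | hy
      · exact ih y hy
      · exact hmem j y hy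
  set f : ℕ → ℕ := fun k => (g (k + 1))[k]'(hlen (k + 1))
  have hfg : ∀ j k, (h : k < (g j).length) → f k = (g j)[k] := by
    intro j k h
    rcases le_total (k + 1) j with hkj | hkj
    · exact (hpre hkj).getElem _
    · exact ((hpre hkj).getElem _).symm
  have hinit : ∀ j, initSeg f (g j).length = g j := by
    intro j
    refine List.ext_getElem (length_initSeg _ _) fun k _ h => ?_
    simpa [initSeg] using hfg j k h
  have hrange : Set.range f = L := by
    ext y
    constructor
    · rintro ⟨k, rfl⟩
      exact hgL (k + 1) _ (List.getElem_mem _)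
    · intro hy
      have : y ∈ g (y + 1) := by rw [hg]; exact List.mem_append_right _ (hcov y hy)
      obtain ⟨k, h, hk⟩ := List.getElem_of_mem this
      exact ⟨k, (hfg _ _ h).trans hk⟩
  intro hM
  obtain ⟨N, hN⟩ := hM f hrange
  obtain ⟨h, hh, hW⟩ := hN (g (N + 1)).length (by have := hlen (N + 1); omega)
  rw [hinit] at hh
  exact hfail N (by rw [conjecture_eq_of_eq_some hh, hW, hrange])

open Classical in
/-- The limit of the witness chains for a learner `M` on `L`. -/
noncomputable def limitChain (M : List ℕ →. ℕ) (L : Set ℕ) (j : ℕ) : List ℕ :=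
  Nat.rec [] (fun j g => if h : ∃ p, IsWitness (· ∈ L) (fun σ x => x ∈ conjecture M σ) g j p then
    g ++ (Denumerable.ofNat (List ℕ × ℕ) (Nat.find h)).1 else g) j

open Classical in
theorem limitChain_succ {M : List ℕ →. ℕ} {L : Set ℕ} {j : ℕ}
    (h : ∃ p, IsWitness (· ∈ L) (fun σ x => x ∈ conjecture M σ) (limitChain M L j) j p) :
    limitChain M L (j + 1) =
      limitChain M L j ++ (Denumerable.ofNat (List ℕ × ℕ) (Nat.find h)).1 :=
  dif_pos h

/-- If `M` learns `L`, the witness chain reaches a locking sequence. -/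
theorem TxtBCLearnsSet.exists_forall_not_isWitness {M : List ℕ →. ℕ} {L : Set ℕ}
    (hM : TxtBCLearnsSet M L) :
    ∃ j, ∀ p, ¬IsWitness (· ∈ L) (fun σ x => x ∈ conjecture M σ) (limitChain M L j) j p := by
  classical
  by_contra! hw
  refine not_txtBCLearnsSet_of_chain (g := limitChain M L)
    (ρ := fun j => (Denumerable.ofNat (List ℕ × ℕ) (Nat.find (hw j))).1)
    (fun j => limitChain_succ (hw j)) rfl (fun j => (Nat.find_spec (hw j)).1)
    (fun j => (Nat.find_spec (hw j)).2.1) (fun j => (Nat.find_spec (hw j)).2.2.1)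
    (fun j hj => ?_) hM
  refine (Nat.find_spec (hw j)).2.2.2 ?_
  simp only [← limitChain_succ (hw j), hj]

section Approximation

variable {M : List ℕ →. ℕ} {T : ℕ → List ℕ × ℕ → Prop}

theorem eventually_stage_iff (hmono : ∀ a k l, k ≤ l → T k a → T l a)
    (hT : ∀ a : List ℕ × ℕ, a.2 ∈ conjecture M a.1 ↔ ∃ k, T k a) {L : Set ℕ}
    (hL : L.Nonempty) (σ : List ℕ) (x : ℕ) :
    ∀ᶠ τ in contentFilter L, (T τ.length (σ, x) ↔ x ∈ conjecture M σ) := by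
  by_cases hx : x ∈ conjecture M σ
  · obtain ⟨k, hk⟩ := (hT (σ, x)).1 hx
    filter_upwards [eventually_le_length_contentFilter hL k] with τ hτ
    exact iff_of_true (hmono _ _ _ hτ hk) hx
  · exact Eventually.of_forall fun τ => iff_of_false (fun h => hx ((hT (σ, x)).2 ⟨_, h⟩)) hx

theorem eventually_isWitness_iff (hmono : ∀ a k l, k ≤ l → T k a → T l a)
    (hT : ∀ a : List ℕ × ℕ, a.2 ∈ conjecture M a.1 ↔ ∃ k, T k a) {L : Set ℕ}
    (hL : L.Nonempty) (g : List ℕ) (j p : ℕ) :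
    ∀ᶠ τ in contentFilter L,
      (IsWitness (· ∈ τ) (fun σ x => T τ.length (σ, x)) g j p ↔
        IsWitness (· ∈ L) (fun σ x => x ∈ conjecture M σ) g j p) := by
  have h : ∀ᶠ τ in contentFilter L, ∀ y ∈ (Denumerable.ofNat (List ℕ × ℕ) p).1,
      (y ∈ τ ↔ y ∈ L) :=
    (eventually_all_finite (List.finite_toSet _)).2 fun y _ => eventually_mem_iff_contentFilter L y
  filter_upwards [h, eventually_mem_iff_contentFilter L j,
    eventually_mem_iff_contentFilter L (Denumerable.ofNat (List ℕ × ℕ) p).2,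
    eventually_stage_iff hmono hT hL (g ++ (Denumerable.ofNat (List ℕ × ℕ) p).1)
      (Denumerable.ofNat (List ℕ × ℕ) p).2] with τ h₁ h₂ h₃ h₄
  simp only [IsWitness, h₂, h₃, h₄]
  have h₅ := forall₂_congr h₁
  simp only [h₅]

theorem eventually_witnessChain_eq (hmono : ∀ a k l, k ≤ l → T k a → T l a)
    (hT : ∀ a : List ℕ × ℕ, a.2 ∈ conjecture M a.1 ↔ ∃ k, T k a) {L : Set ℕ}
    (hL : L.Nonempty) (j : ℕ)
    (hj : ∀ i < j, ∃ p,
      IsWitness (· ∈ L) (fun σ x => x ∈ conjecture M σ) (limitChain M L i) i p) :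
    ∀ᶠ τ in contentFilter L,
      witnessChain (· ∈ τ) (fun σ x => T τ.length (σ, x)) τ.length j = limitChain M L j := by
  classical
  induction j with
  | zero => exact Eventually.of_forall fun _ => rfl
  | succ j ih =>
    have hw := hj j j.lt_succ_self
    have hle : ∀ᶠ τ in contentFilter L, ∀ q ∈ Set.Iic (Nat.find hw),
        (IsWitness (· ∈ τ) (fun σ x => T τ.length (σ, x)) (limitChain M L j) j q ↔
          IsWitness (· ∈ L) (fun σ x => x ∈ conjecture M σ) (limitChain M L j) j q) :=
      (eventually_all_finite (Set.finite_Iic _)).2 fun q _ =>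
        eventually_isWitness_iff hmono hT hL _ j q
    filter_upwards [ih fun i hi => hj i (hi.trans j.lt_succ_self), hle,
      eventually_le_length_contentFilter hL (Nat.find hw + 1)] with τ h₁ h₂ h₃
    rw [limitChain_succ hw, ← witnessStep_of_isLeast h₃
      ((h₂ _ (Set.mem_Iic.2 le_rfl)).2 (Nat.find_spec hw))
      fun q hq => (h₂ q hq.le).not.2 (Nat.find_min hw hq), ← h₁]
    rfl

/-- The learner that runs `M` along the witness chain approximated from the content and the length
of the input. -/
noncomputable def chainLearner (M : List ℕ →. ℕ) (T : ℕ → List ℕ × ℕ → Prop) : List ℕ →. ℕ :=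
  fun τ => M (witnessChain (· ∈ τ) (fun σ x => T τ.length (σ, x)) τ.length τ.length ++ τ)

theorem TxtBCLearnsSet.contentLocks_chainLearner
    (hmono : ∀ a k l, k ≤ l → T k a → T l a)
    (hT : ∀ a : List ℕ × ℕ, a.2 ∈ conjecture M a.1 ↔ ∃ k, T k a) {L : Set ℕ}
    (hM : TxtBCLearnsSet M L) : ContentLocks (chainLearner M T) L := by
  classical
  rcases L.eq_empty_or_nonempty with rfl | hL
  · refine ⟨[], by simp, fun τ h _ hlt => ?_⟩
    obtain ⟨a, ha⟩ := List.exists_mem_of_length_pos hlt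
    exact (h a ha).elim
  have hex := hM.exists_forall_not_isWitness
  obtain ⟨j, hlock, hmin⟩ : ∃ j, (∀ p, ¬IsWitness (· ∈ L) (fun σ x => x ∈ conjecture M σ)
      (limitChain M L j) j p) ∧ ∀ i < j, ∃ p,
        IsWitness (· ∈ L) (fun σ x => x ∈ conjecture M σ) (limitChain M L i) i p :=
    ⟨Nat.find hex, Nat.find_spec hex, fun i hi => by simpa using Nat.find_min hex hi⟩
  have hchain := eventually_witnessChain_eq hmono hT hL j hmin
  have hev : ∀ᶠ τ in contentFilter L, conjecture (chainLearner M T) τ = L := by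
    filter_upwards [hchain, eventually_forall_mem_contentFilter L,
      eventually_mem_iff_contentFilter L j,
      eventually_le_length_contentFilter hL (max j 1)] with τ h₁ h₂ h₃ h₄
    obtain ⟨ρ, hρ⟩ := witnessChain_prefix (· ∈ τ) (fun σ x => T τ.length (σ, x)) τ.length
      (le_of_max_le_left h₄)
    rw [h₁] at hρ
    ext z
    by_contra hz
    refine hlock (Encodable.encode (ρ ++ τ, z)) ?_
    simp only [IsWitness, Denumerable.ofNat_encode]
    refine ⟨?_, ?_, ?_, ?_⟩
    · have : τ ≠ [] := List.length_pos_iff.1 (le_of_max_le_right h₄)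
      simp [this]
    · intro y hy
      rcases List.mem_append.1 hy with hy | hy
      · exact h₂ y (forall_mem_witnessChain (· ∈ τ) (fun σ x => T τ.length (σ, x)) τ.length
          τ.length y (hρ ▸ List.mem_append_right _ hy))
      · exact h₂ y hy
    · exact fun hj => List.mem_append_right _ (h₃.2 hj)
    · rw [← List.append_assoc, hρ]
      exact fun h => hz h.symm
  obtain ⟨σ, hσ, h⟩ := eventually_contentFilter.1 hev
  exact ⟨σ, hσ, fun τ h₁ h₂ h₃ => h τ h₁ h₂ h₃.le⟩

end Approximation

/-! ### Computability of the chain learner -/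

theorem PrimrecRel.list_mem : PrimrecRel fun (x : ℕ) (l : List ℕ) => x ∈ l :=
  PrimrecPred.of_eq ((PrimrecRel.exists_mem_list Primrec.eq).comp Primrec.snd Primrec.fst)
    fun a => by simp

theorem PrimrecRel.list_subset : PrimrecRel fun l l' : List ℕ => ∀ y ∈ l, y ∈ l' :=
  PrimrecRel.list_mem.forall_mem_list

theorem primrecPred_isWitness {T : ℕ → List ℕ × ℕ → Prop} (hT : PrimrecRel T) :
    PrimrecPred fun a : (List ℕ × List ℕ × ℕ) × ℕ =>
      IsWitness (· ∈ a.1.1) (fun σ x => T a.1.1.length (σ, x)) a.1.2.1 a.1.2.2 a.2 := by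
  have hτ : Primrec fun a : (List ℕ × List ℕ × ℕ) × ℕ => a.1.1 := Primrec.fst.comp Primrec.fst
  have hg : Primrec fun a : (List ℕ × List ℕ × ℕ) × ℕ => a.1.2.1 :=
    Primrec.fst.comp (Primrec.snd.comp Primrec.fst)
  have hj : Primrec fun a : (List ℕ × List ℕ × ℕ) × ℕ => a.1.2.2 :=
    Primrec.snd.comp (Primrec.snd.comp Primrec.fst)
  have hp : Primrec fun a : (List ℕ × List ℕ × ℕ) × ℕ => Denumerable.ofNat (List ℕ × ℕ) a.2 :=
    (Primrec.ofNat _).comp Primrec.snd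
  have hρ := Primrec.fst.comp hp
  have hz := Primrec.snd.comp hp
  have h₁ := (Primrec.eq.comp hρ (Primrec.const [])).not
  have h₂ := PrimrecRel.list_subset.comp hρ hτ
  have h₃ := (PrimrecRel.list_mem.comp hj hτ).not.or (PrimrecRel.list_mem.comp hj hρ)
  have h₄ := PrimrecRel.list_mem.comp hz hτ
  have h₅ := hT.comp (Primrec.list_length.comp hτ) ((Primrec.list_append.comp hg hρ).pair hz)
  refine PrimrecPred.of_eq
    (h₁.and (h₂.and (h₃.and ((h₄.and h₅).or (h₄.not.and h₅.not)).not))) fun a => ?_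
  simp only [IsWitness, ne_eq]
  tauto

theorem primrec_witnessStep {T : ℕ → List ℕ × ℕ → Prop} (hT : PrimrecRel T) :
    Primrec fun a : List ℕ × List ℕ × ℕ =>
      witnessStep (· ∈ a.1) (fun σ x => T a.1.length (σ, x)) a.1.length a.2.1 a.2.2 := by
  classical
  have hn : Primrec fun a : List ℕ × List ℕ × ℕ => a.1.length :=
    Primrec.list_length.comp Primrec.fst
  have hp : Primrec fun a : List ℕ × List ℕ × ℕ => (List.range a.1.length).findIdx fun p =>
      decide (IsWitness (· ∈ a.1) (fun σ x => T a.1.length (σ, x)) a.2.1 a.2.2 p) :=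
    Primrec.list_findIdx (Primrec.list_range.comp hn) (primrecPred_isWitness hT).decide
  have hg : Primrec fun a : List ℕ × List ℕ × ℕ => a.2.1 := Primrec.fst.comp Primrec.snd
  simp only [witnessStep]
  exact Primrec.ite (Primrec.nat_lt.comp hp hn)
    (Primrec.list_append.comp hg (Primrec.fst.comp ((Primrec.ofNat (List ℕ × ℕ)).comp hp))) hg

theorem Partrec.chainLearner {M : List ℕ →. ℕ} (hM : Partrec M) {T : ℕ → List ℕ × ℕ → Prop}
    (hT : PrimrecRel T) : Partrec (chainLearner M T) := by
  have h : Primrec fun τ : List ℕ =>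
      witnessChain (· ∈ τ) (fun σ x => T τ.length (σ, x)) τ.length τ.length :=
    Primrec.nat_rec' Primrec.list_length (Primrec.const []) (h := fun τ a =>
      witnessStep (· ∈ τ) (fun σ x => T τ.length (σ, x)) τ.length a.2 a.1)
      ((primrec_witnessStep hT).comp (Primrec.fst.pair ((Primrec.snd.comp Primrec.snd).pair
        (Primrec.fst.comp Primrec.snd)))).to₂
  exact hM.comp (Primrec.list_append.comp h Primrec.id).to_comp

/-- The family coded by `e` is BC-learnable iff a single learner content-locks on all its
members. -/
theorem mem_BCL_iff {e : ℕ} :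
    e ∈ BCL ↔ ∃ c, ∀ i, ContentLocks (learnerOfCode c) (column e i) := by
  constructor
  · rintro ⟨M, hM, hlearn⟩
    obtain ⟨T, hT, hmono, hspec⟩ := (REPred.mem_conjecture (M := fun _ : List ℕ × ℕ => M)
      (hM.comp Computable.fst) Computable.snd).exists_primrecRel_stage
    obtain ⟨c, hc⟩ := (hM.chainLearner hT).exists_learnerOfCode
    exact ⟨c, fun i => hc ▸ (hlearn i).contentLocks_chainLearner hmono hspec⟩
  · rintro ⟨c, hc⟩
    exact ⟨learnerOfCode c, partrec_learnerOfCode.comp (Computable.const c) Computable.id,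
      fun i => (hc i).txtBCLearnsSet⟩

/-! ### The arithmetical form -/

/-- The matrix of the `∃∀∃∀∃` form of content locking, where `A` and `U` are the stages of the
set and of the conjectures. -/
def LocksMatrix (A : ℕ → ℕ → Prop) (U : ℕ → List ℕ × ℕ → Prop) (z : List ℕ × ℕ)
    (w : (List ℕ × ℕ) × ℕ × ℕ) (v : ℕ) : Prop :=
  (∀ y ∈ z.1, A z.2 y) ∧
  ((∀ y ∈ w.1.1, A w.1.2 y) ∧ (∀ y ∈ z.1, y ∈ w.1.1) ∧ z.1.length < w.1.1.length →
    (A w.2.2 w.2.1 → U v (w.1.1, w.2.1)) ∧ (U w.2.2 (w.1.1, w.2.1) → A v w.2.1))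

theorem forall_mem_iff_exists_stage {L : Set ℕ} {A : ℕ → ℕ → Prop}
    (hmono : ∀ a k l, k ≤ l → A k a → A l a) (hA : ∀ a, a ∈ L ↔ ∃ k, A k a) (σ : List ℕ) :
    (∀ y ∈ σ, y ∈ L) ↔ ∃ s, ∀ y ∈ σ, A s y := by
  constructor
  · intro h
    refine (Eventually.exists (f := atTop) ?_)
    refine (eventually_all_finite σ.finite_toSet).2 fun y hy => ?_
    obtain ⟨k, hk⟩ := (hA y).1 (h y hy)
    filter_upwards [eventually_ge_atTop k] with s hs using hmono _ _ _ hs hk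
  · rintro ⟨s, hs⟩ y hy
    exact (hA y).2 ⟨s, hs y hy⟩

theorem contentLocks_iff_locksMatrix {M : List ℕ →. ℕ} {L : Set ℕ} {A : ℕ → ℕ → Prop}
    {U : ℕ → List ℕ × ℕ → Prop} (hAmono : ∀ a k l, k ≤ l → A k a → A l a)
    (hA : ∀ a, a ∈ L ↔ ∃ k, A k a) (hUmono : ∀ a k l, k ≤ l → U k a → U l a)
    (hU : ∀ a : List ℕ × ℕ, a.2 ∈ conjecture M a.1 ↔ ∃ k, U k a) :
    ContentLocks M L ↔ ∃ z, ∀ w, ∃ v, LocksMatrix A U z w v := by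
  constructor
  · rintro ⟨σ, hσ, h⟩
    obtain ⟨s, hs⟩ := (forall_mem_iff_exists_stage hAmono hA σ).1 hσ
    refine ⟨(σ, s), fun ⟨⟨τ, t⟩, x, r⟩ => ?_⟩
    by_cases hτ : (∀ y ∈ τ, A t y) ∧ (∀ y ∈ σ, y ∈ τ) ∧ σ.length < τ.length
    · have hconj := h τ ((forall_mem_iff_exists_stage hAmono hA τ).2 ⟨t, hτ.1⟩) hτ.2.1 hτ.2.2
      by_cases hx : x ∈ L
      · obtain ⟨k, hk⟩ := (hA x).1 hx
        obtain ⟨l, hl⟩ := (hU (τ, x)).1 (hconj.symm ▸ hx)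
        exact ⟨max k l, hs, fun _ => ⟨fun _ => hUmono _ _ _ (le_max_right _ _) hl,
          fun _ => hAmono _ _ _ (le_max_left _ _) hk⟩⟩
      · exact ⟨0, hs, fun _ => ⟨fun h => (hx ((hA x).2 ⟨r, h⟩)).elim,
          fun h => (hx (hconj ▸ (hU (τ, x)).2 ⟨r, h⟩)).elim⟩⟩
    · exact ⟨0, hs, fun h => (hτ h).elim⟩
  · rintro ⟨⟨σ, s⟩, h⟩
    refine ⟨σ, (forall_mem_iff_exists_stage hAmono hA σ).2 ⟨s, ?_⟩, fun τ h₁ h₂ h₃ => ?_⟩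
    · obtain ⟨v, hv⟩ := h (([], 0), 0, 0)
      exact hv.1
    · obtain ⟨t, ht⟩ := (forall_mem_iff_exists_stage hAmono hA τ).1 h₁
      ext x
      constructor
      · intro hx
        obtain ⟨r, hr⟩ := (hU (τ, x)).1 hx
        obtain ⟨v, hv⟩ := h ((τ, t), x, r)
        exact (hA x).2 ⟨v, (hv.2 ⟨ht, h₂, h₃⟩).2 hr⟩
      · intro hx
        obtain ⟨r, hr⟩ := (hA x).1 hx
        obtain ⟨v, hv⟩ := h ((τ, t), x, r)
        exact (hU (τ, x)).2 ⟨v, (hv.2 ⟨ht, h₂, h₃⟩).1 hr⟩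

theorem PrimrecRel.locksMatrix {α : Type*} [Primcodable α] {A : ℕ → α × ℕ → Prop}
    {U : ℕ → α × List ℕ × ℕ → Prop} (hA : PrimrecRel A) (hU : PrimrecRel U)
    {b : α → List ℕ × ℕ} {d : α → (List ℕ × ℕ) × ℕ × ℕ} {v : α → ℕ}
    (hb : Primrec b) (hd : Primrec d) (hv : Primrec v) :
    PrimrecPred fun a =>
      LocksMatrix (fun k x => A k (a, x)) (fun k y => U k (a, y)) (b a) (d a) (v a) := by
  have hall : PrimrecRel fun (l : List ℕ) (q : ℕ × α) => ∀ y ∈ l, A q.1 (q.2, y) :=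
    PrimrecRel.forall_mem_list (R := fun y (q : ℕ × α) => A q.1 (q.2, y))
      (hA.comp (Primrec.fst.comp Primrec.snd)
        ((Primrec.snd.comp Primrec.snd).pair Primrec.fst))
  have hσ := Primrec.fst.comp hb
  have hτt := Primrec.fst.comp hd
  have hτ := Primrec.fst.comp hτt
  have hx := Primrec.fst.comp (Primrec.snd.comp hd)
  have hr := Primrec.snd.comp (Primrec.snd.comp hd)
  have h₁ := hall.comp hσ ((Primrec.snd.comp hb).pair Primrec.id)
  have h₂ := hall.comp hτ ((Primrec.snd.comp hτt).pair Primrec.id)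
  have h₃ := PrimrecRel.list_subset.comp hσ hτ
  have h₄ := Primrec.nat_lt.comp (Primrec.list_length.comp hσ) (Primrec.list_length.comp hτ)
  have hAx := fun {k : α → ℕ} (hk : Primrec k) => hA.comp hk (Primrec.id.pair hx)
  have hUx := fun {k : α → ℕ} (hk : Primrec k) => hU.comp hk (Primrec.id.pair (hτ.pair hx))
  refine PrimrecPred.of_eq (h₁.and ((h₂.and (h₃.and h₄)).not.or
    (((hAx hr).not.or (hUx hv)).and ((hUx hr).not.or (hAx hv))))) fun a => ?_
  simp only [LocksMatrix, imp_iff_not_or]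
  rfl

/-- BCL is a Σ⁰₅ set. -/
theorem BCL_isSigma5 : IsSigma5 BCL := by
  classical
  obtain ⟨A, hA, hAmono, hAspec⟩ := (REPred.mem_Wset (α := (ℕ × ℕ × ℕ) × ℕ)
    (f := fun a => a.1.1) (g := fun a => Nat.pair a.1.2.2 a.2)
    (Computable.fst.comp Computable.fst)
    (Primrec₂.natPair.comp (Primrec.snd.comp (Primrec.snd.comp Primrec.fst))
      Primrec.snd).to_comp).exists_primrecRel_stage
  obtain ⟨U, hU, hUmono, hUspec⟩ := (REPred.mem_conjecture
    (α := (ℕ × ℕ × ℕ) × List ℕ × ℕ) (M := fun a => learnerOfCode a.1.2.1)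
    (σ := fun a => a.2.1) (x := fun a => a.2.2)
    (partrec_learnerOfCode.comp (Computable.fst.comp (Computable.snd.comp Computable.fst))
      (Computable.fst.comp Computable.snd))
    (Computable.snd.comp Computable.snd)).exists_primrecRel_stage
  refine ⟨fun e c i z w v => decide (LocksMatrix (fun k x => A k ((e, c, i), x))
    (fun k y => U k ((e, c, i), y)) (Denumerable.ofNat (List ℕ × ℕ) z)
    (Denumerable.ofNat ((List ℕ × ℕ) × ℕ × ℕ) w) v), ?_, fun e => ?_⟩
  · have hctx : Primrec fun a : ℕ × ℕ × ℕ × ℕ × ℕ × ℕ => (a.1, a.2.1, a.2.2.1) :=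
      Primrec.fst.pair ((Primrec.fst.comp Primrec.snd).pair
        (Primrec.fst.comp (Primrec.snd.comp Primrec.snd)))
    have hsnd := Primrec.snd.comp (Primrec.snd.comp
      (Primrec.snd (α := ℕ) (β := ℕ × ℕ × ℕ × ℕ × ℕ)))
    exact (PrimrecRel.locksMatrix (α := ℕ × ℕ × ℕ × ℕ × ℕ × ℕ)
      (A := fun k q => A k ((q.1.1, q.1.2.1, q.1.2.2.1), q.2))
      (U := fun k q => U k ((q.1.1, q.1.2.1, q.1.2.2.1), q.2))
      (hA.comp Primrec.fst ((hctx.comp (Primrec.fst.comp Primrec.snd)).pair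
        (Primrec.snd.comp Primrec.snd)))
      (hU.comp Primrec.fst ((hctx.comp (Primrec.fst.comp Primrec.snd)).pair
        (Primrec.snd.comp Primrec.snd)))
      ((Primrec.ofNat (List ℕ × ℕ)).comp (Primrec.fst.comp hsnd))
      ((Primrec.ofNat ((List ℕ × ℕ) × ℕ × ℕ)).comp
        (Primrec.fst.comp (Primrec.snd.comp hsnd)))
      (Primrec.snd.comp (Primrec.snd.comp hsnd))).decide.to_comp
  · rw [mem_BCL_iff]
    simp only [decide_eq_true_eq]
    refine exists_congr fun c => forall_congr' fun i => ?_
    refine (contentLocks_iff_locksMatrix (M := learnerOfCode c) (L := column e i)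
      (A := fun k x => A k ((e, c, i), x)) (U := fun k y => U k ((e, c, i), y))
      (fun _ => hAmono _) (fun x => hAspec ((e, c, i), x))
      (fun _ => hUmono _) (fun y => hUspec ((e, c, i), y))).trans ?_
    rw [(Denumerable.eqv (List ℕ × ℕ)).symm.surjective.exists]
    refine exists_congr fun z => ?_
    rw [(Denumerable.eqv ((List ℕ × ℕ) × ℕ × ℕ)).symm.surjective.forall]
    rfl
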